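/- arXiv:1902.03571 — 2 statements merged into one kernel-verified Lean document; each statement's English description precedes it below -/
import Mathlib

section
/- Let (a, b, c) be a primitive Pythagorean triple with (a, b, c) ≠ (3, 4, 5) and (a, b, c) ≠ (4, 3, 5). Then there is exactly one j ∈ {1, 2, 3} such that M_j⁻¹·(a, b, c) = U_j·H·(a, b, c) is a primitive Pythagorean triple; and for this j, writing M_j⁻¹·(a, b, c) = (a', b', c'), one has c' < c. -/
/-- The reflection H = s_{(1,1,1)} (integer version). -/
def Hmat : Matrix (Fin 3) (Fin 3) ℤ := !![-1, -2, 2; -2, -1, 2; -2, -2, 3]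

/-- The reflections U₁, U₂, U₃ (indexed by `Fin 3`, so `Umat 0 = U₁`, etc.). -/
def Umat : Fin 3 → Matrix (Fin 3) (Fin 3) ℤ :=
  ![!![1, 0, 0; 0, -1, 0; 0, 0, 1],
    !![-1, 0, 0; 0, -1, 0; 0, 0, 1],
    !![-1, 0, 0; 0, 1, 0; 0, 0, 1]]

/-- `M_j⁻¹ · v = U_j · H · v`. -/
def Minv (j : Fin 3) (v : Fin 3 → ℤ) : Fin 3 → ℤ := (Umat j * Hmat).mulVec v

/-- `(a, b, c)` is a primitive Pythagorean triple. -/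
def IsPPT (a b c : ℤ) : Prop :=
  0 < a ∧ 0 < b ∧ 0 < c ∧ Int.gcd (Int.gcd a b) c = 1 ∧ a ^ 2 + b ^ 2 = c ^ 2

theorem gcd_gcd_eq_one_iff (a b c : ℤ) :
    Int.gcd (Int.gcd a b) c = 1 ↔ ∀ d : ℤ, d ∣ a → d ∣ b → d ∣ c → IsUnit d := by
  constructor
  · intro h d ha hb hc
    have hd : d ∣ ((Int.gcd (Int.gcd a b) c : ℕ) : ℤ) :=
      Int.dvd_coe_gcd (Int.dvd_coe_gcd ha hb) hc
    rw [h] at hd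
    exact isUnit_of_dvd_one (by simpa using hd)
  · intro h
    have hab := Int.gcd_dvd_left (Int.gcd a b : ℤ) c
    have hu := h (Int.gcd (Int.gcd a b) c) (hab.trans (Int.gcd_dvd_left a b))
      (hab.trans (Int.gcd_dvd_right a b)) (Int.gcd_dvd_right _ c)
    simpa using Int.isUnit_iff_natAbs_eq.1 hu

theorem Minv_zero (a b c : ℤ) : Minv 0 ![a, b, c] =
    ![-a - 2 * b + 2 * c, 2 * a + b - 2 * c, -2 * a - 2 * b + 3 * c] := by
  ext i
  fin_cases i <;> simp [Minv, Umat, Hmat, Matrix.mulVec, dotProduct, Fin.sum_univ_three] <;> ring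

theorem Minv_one (a b c : ℤ) : Minv 1 ![a, b, c] =
    ![a + 2 * b - 2 * c, 2 * a + b - 2 * c, -2 * a - 2 * b + 3 * c] := by
  ext i
  fin_cases i <;> simp [Minv, Umat, Hmat, Matrix.mulVec, dotProduct, Fin.sum_univ_three] <;> ring

theorem Minv_two (a b c : ℤ) : Minv 2 ![a, b, c] =
    ![a + 2 * b - 2 * c, -2 * a - b + 2 * c, -2 * a - 2 * b + 3 * c] := by
  ext i
  fin_cases i <;> simp [Minv, Umat, Hmat, Matrix.mulVec, dotProduct, Fin.sum_univ_three] <;> ring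

/-- Up to the signs of the legs, the reflection `H` preserves primitive Pythagorean triples. -/
theorem IsPPT.reflect {a b c x y : ℤ} (h : IsPPT a b c)
    (hx : x = -a - 2 * b + 2 * c ∨ x = a + 2 * b - 2 * c)
    (hy : y = -2 * a - b + 2 * c ∨ y = 2 * a + b - 2 * c) (hx0 : 0 < x) (hy0 : 0 < y) :
    IsPPT x y (-2 * a - 2 * b + 3 * c) := by
  obtain ⟨ha, hb, hc, hg, hp⟩ := h
  refine ⟨hx0, hy0, by nlinarith [sq_nonneg (a - b)], ?_, ?_⟩
  · rw [gcd_gcd_eq_one_iff] at hg ⊢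
    intro d hdx hdy hdz
    have hdp : d ∣ -a - 2 * b + 2 * c := by
      rcases hx with rfl | rfl
      · exact hdx
      · exact (dvd_neg.2 hdx).trans (dvd_of_eq (by ring))
    have hdq : d ∣ -2 * a - b + 2 * c := by
      rcases hy with rfl | rfl
      · exact hdy
      · exact (dvd_neg.2 hdy).trans (dvd_of_eq (by ring))
    obtain ⟨k, hk⟩ := hdp
    obtain ⟨l, hl⟩ := hdq
    obtain ⟨m, hm⟩ := hdz
    exact hg d ⟨-k - 2 * l + 2 * m, by linear_combination -hk - 2 * hl + 2 * hm⟩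
      ⟨-2 * k - l + 2 * m, by linear_combination -2 * hk - hl + 2 * hm⟩
      ⟨-2 * k - 2 * l + 3 * m, by linear_combination -2 * hk - 2 * hl + 3 * hm⟩
  · rcases hx with rfl | rfl <;> rcases hy with rfl | rfl <;> linear_combination hp

theorem IsPPT.symm {a b c : ℤ} (h : IsPPT a b c) : IsPPT b a c := by
  obtain ⟨ha, hb, hc, hg, hp⟩ := h
  exact ⟨hb, ha, hc, by rwa [Int.gcd_comm b a], by linarith⟩

theorem IsPPT.eq_of_add_two_mul_eq {a b c : ℤ} (h : IsPPT a b c) (h0 : a + 2 * b = 2 * c) :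
    a = 4 ∧ b = 3 ∧ c = 5 := by
  obtain ⟨ha, hb, hc, hg, hp⟩ := h
  have hab : 3 * a = 4 * b := mul_left_cancel₀ ha.ne' (by
    linear_combination 4 * hp - (a + 2 * b + 2 * c) * h0)
  obtain ⟨k, rfl⟩ : ∃ k, b = 3 * k := ⟨b / 3, by lia⟩
  have hk := (gcd_gcd_eq_one_iff _ _ _).1 hg k ⟨4, by lia⟩ ⟨3, by lia⟩ ⟨5, by lia⟩
  rcases Int.isUnit_iff.1 hk with rfl | rfl <;> lia

theorem stmt_5 (a b c : ℤ) (h : IsPPT a b c)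
    (h345 : ¬(a = 3 ∧ b = 4 ∧ c = 5)) (h435 : ¬(a = 4 ∧ b = 3 ∧ c = 5)) :
    (∃! j : Fin 3,
      IsPPT (Minv j ![a, b, c] 0) (Minv j ![a, b, c] 1) (Minv j ![a, b, c] 2)) ∧
    (∀ j : Fin 3,
      IsPPT (Minv j ![a, b, c] 0) (Minv j ![a, b, c] 1) (Minv j ![a, b, c] 2) →
      Minv j ![a, b, c] 2 < c) := by
  have hs := h.symm
  have hp0 : a + 2 * b - 2 * c ≠ 0 := fun h0 => h435 (h.eq_of_add_two_mul_eq (by linarith))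
  have hq0 : 2 * a + b - 2 * c ≠ 0 := fun h0 =>
    h345 (by have := hs.eq_of_add_two_mul_eq (by linarith); tauto)
  obtain ⟨ha, hb, hc, -, hp⟩ := id h
  have hlt : c < a + b := by nlinarith [mul_pos ha hb]
  have hpq : 0 < a + 2 * b - 2 * c ∨ 0 < 2 * a + b - 2 * c := by
    by_contra! hn
    have h1 : 4 * b ≤ 3 * a := le_of_mul_le_mul_left (by nlinarith) ha
    have h2 : 4 * a ≤ 3 * b := le_of_mul_le_mul_left (by nlinarith) hb
    linarith
  refine ⟨?_, ?_⟩
  · rcases lt_or_gt_of_ne hp0 with hpn | hpp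
    · refine ⟨0, ?_, ?_⟩
      · simpa [Minv_zero] using h.reflect (.inl rfl) (.inr rfl) (by linarith) (by lia)
      · intro j hj
        fin_cases j <;> simp [Minv_one, Minv_two, IsPPT] at hj ⊢ <;> lia
    · rcases lt_or_gt_of_ne hq0 with hqn | hqp
      · refine ⟨2, ?_, ?_⟩
        · simpa [Minv_two] using h.reflect (.inr rfl) (.inl rfl) hpp (by linarith)
        · intro j hj
          fin_cases j <;> simp [Minv_zero, Minv_one, IsPPT] at hj ⊢ <;> lia
      · refine ⟨1, ?_, ?_⟩
        · simpa [Minv_one] using h.reflect (.inr rfl) (.inr rfl) hpp hqp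
        · intro j hj
          fin_cases j <;> simp [Minv_zero, Minv_two, IsPPT] at hj ⊢ <;> lia
  · intro j _
    fin_cases j <;> simp [Minv_zero, Minv_one, Minv_two] <;> linarith
end

section
/- Let k ≥ 1, let d₁, …, d_k ∈ {1, 2, 3}, and let M = M_{d₁}·M_{d₂}·⋯·M_{d_k}. Assume that not all d_i equal 1 and not all d_i equal 3. Then there exist a real number λ > 1 with λ irrational and λ² − (tr(M) − det(M))·λ + 1 = 0, reals α, β with α ≥ 0, β ≥ 0, α² + β² = 1 and M·(α, β, 1) = λ·(α, β, 1), and rationals a, b, c, e with α = a + b·λ and β = c + e·λ. Moreover, setting α' = a + b·λ⁻¹ and β' = c + e·λ⁻¹, one has α'² + β'² = 1, NOT(α' ≥ 0 and β' ≥ 0), and M·(α', β', 1) = λ⁻¹·(α', β', 1); det(M) ∈ {1, −1}; and the vector (α, β, 1) ×_Q (α', β', 1) is an eigenvector of M with eigenvalue det(M). -/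
/-- The Berggren matrices M₁, M₂, M₃ over ℝ (indexed by `Fin 3`, so `Mmat 0 = M₁`). -/
def Mmat : Fin 3 → Matrix (Fin 3) (Fin 3) ℝ :=
  ![!![-1, 2, 2; -2, 1, 2; -2, 2, 3],
    !![1, 2, 2; 2, 1, 2; 2, 2, 3],
    !![1, -2, 2; 2, -1, 2; 2, -2, 3]]

/-- The Q-cross product `v ×_Q w` for the Pythagorean form. -/
def qcross (v w : Fin 3 → ℝ) : Fin 3 → ℝ :=
  ![v 1 * w 2 - w 1 * v 2, w 0 * v 2 - v 0 * w 2, w 0 * v 1 - v 0 * w 1]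

/-- The action on `(m² - n², 2mn, m² + n²)` induced by the matrix `!![x, y; z, w]` acting on the
coordinates `(p, q) = (m - n, n)`. -/
noncomputable def symSquare (x y z w : ℝ) : Matrix (Fin 3) (Fin 3) ℝ :=
  let a := x + z
  let b := y + w - x - z
  let c := z
  let d := w - z
  !![(a ^ 2 - b ^ 2 - c ^ 2 + d ^ 2) / 2, a * b - c * d, (a ^ 2 + b ^ 2 - c ^ 2 - d ^ 2) / 2;
    a * c - b * d, a * d + b * c, a * c + b * d;
    (a ^ 2 - b ^ 2 + c ^ 2 - d ^ 2) / 2, a * b + c * d, (a ^ 2 + b ^ 2 + c ^ 2 + d ^ 2) / 2]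

lemma symSquare_mul (x y z w x' y' z' w' : ℝ) :
    symSquare x y z w * symSquare x' y' z' w' =
      symSquare (x * x' + y * z') (x * y' + y * w') (z * x' + w * z') (z * y' + w * w') := by
  ext i j
  fin_cases i <;> fin_cases j <;>
    simp [symSquare, Matrix.mul_apply, Fin.sum_univ_three] <;> ring

lemma symSquare_one : symSquare 1 0 0 1 = 1 := by
  ext i j
  fin_cases i <;> fin_cases j <;> simp [symSquare]

lemma Mmat_zero_eq_symSquare : Mmat 0 = symSquare 1 2 0 1 := by
  ext i j
  fin_cases i <;> fin_cases j <;> norm_num [symSquare, Mmat]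

lemma Mmat_one_eq_symSquare : Mmat 1 = symSquare 1 2 1 1 := by
  ext i j
  fin_cases i <;> fin_cases j <;> norm_num [symSquare, Mmat]

lemma Mmat_two_eq_symSquare : Mmat 2 = symSquare 1 0 1 1 := by
  change !![1, -2, 2; 2, -1, 2; 2, -2, 3] = symSquare 1 0 1 1
  ext i j
  fin_cases i <;> fin_cases j <;> norm_num [symSquare]

lemma det_symSquare (x y z w : ℝ) : (symSquare x y z w).det = (x * w - y * z) ^ 3 := by
  simp [symSquare, Matrix.det_fin_three]
  ring

lemma trace_symSquare (x y z w : ℝ) :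
    (symSquare x y z w).trace = (x + w) ^ 2 - (x * w - y * z) := by
  simp [symSquare, Matrix.trace_fin_three]
  ring

lemma qcross_symSquare_mulVec (x y z w : ℝ) (u v : Fin 3 → ℝ) :
    qcross ((symSquare x y z w).mulVec u) ((symSquare x y z w).mulVec v) =
      (x * w - y * z) • (symSquare x y z w).mulVec (qcross u v) := by
  ext i
  fin_cases i <;>
    simp [symSquare, qcross, Matrix.mulVec, dotProduct, Fin.sum_univ_three] <;> ring

lemma qcross_smul_smul (s t : ℝ) (u v : Fin 3 → ℝ) :
    qcross (s • u) (t • v) = (s * t) • qcross u v := by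
  ext i
  fin_cases i <;> simp [qcross] <;> ring

/-- The rational parametrization of the unit circle attached to the ratio `r = (m - n) / n`. -/
noncomputable def circlePoint (r : ℝ) : Fin 3 → ℝ :=
  ![(r ^ 2 + 2 * r) / (r ^ 2 + 2 * r + 2), (2 * r + 2) / (r ^ 2 + 2 * r + 2), 1]

lemma circlePoint_denom_pos (r : ℝ) : 0 < r ^ 2 + 2 * r + 2 := by
  nlinarith [sq_nonneg (r + 1)]

lemma circlePoint_denom_ne_zero (r : ℝ) : r * (r + 2) + 2 ≠ 0 := by
  nlinarith [sq_nonneg (r + 1)]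

lemma circlePoint_norm (r : ℝ) :
    ((r ^ 2 + 2 * r) / (r ^ 2 + 2 * r + 2)) ^ 2 + ((2 * r + 2) / (r ^ 2 + 2 * r + 2)) ^ 2 = 1 := by
  have h := circlePoint_denom_ne_zero r
  field_simp
  ring

lemma symSquare_mulVec_circlePoint {x y z w r μ : ℝ} (h₁ : x * r + y = μ * r)
    (h₂ : z * r + w = μ) :
    (symSquare x y z w).mulVec (circlePoint r) = μ ^ 2 • circlePoint r := by
  have h := circlePoint_denom_ne_zero r
  obtain rfl : w = μ - z * r := by linarith
  obtain rfl : y = μ * r - x * r := by linarith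
  ext i
  fin_cases i <;>
    simp [symSquare, circlePoint, Matrix.mulVec, dotProduct, Fin.sum_univ_three] <;>
    field_simp <;> ring

lemma circlePoint_not_nonneg {r : ℝ} (hr : r < 0) :
    ¬(0 ≤ (r ^ 2 + 2 * r) / (r ^ 2 + 2 * r + 2) ∧ 0 ≤ (2 * r + 2) / (r ^ 2 + 2 * r + 2)) := by
  have h := circlePoint_denom_pos r
  rintro ⟨h₁, h₂⟩
  rw [le_div_iff₀ h] at h₁ h₂
  nlinarith

/-- For conjugate roots `r, r'` of `X² - s X - k`, the circle point of `r` is affine in `r`. -/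
lemma circlePoint_affine {r r' s k : ℝ} (hs : r + r' = s) (hk : r * r' = -k) :
    (r ^ 2 + 2 * r) / (r ^ 2 + 2 * r + 2) =
        1 - 2 * ((s + 2) * (s - r) + k + 2) /
          (-(s + 2) ^ 2 * k + (s + 2) * (k + 2) * s + (k + 2) ^ 2) ∧
      (2 * r + 2) / (r ^ 2 + 2 * r + 2) =
        2 * ((k - s) * r + (s + 2) * (s - k) + k + 2) /
          (-(s + 2) ^ 2 * k + (s + 2) * (k + 2) * s + (k + 2) ^ 2) := by
  obtain rfl : k = -(r * r') := by linarith
  subst hs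
  have h := circlePoint_denom_ne_zero r
  have h' := circlePoint_denom_ne_zero r'
  have hN : -(r + r' + 2) ^ 2 * -(r * r') + (r + r' + 2) * (-(r * r') + 2) * (r + r') +
      (-(r * r') + 2) ^ 2 = (r ^ 2 + 2 * r + 2) * (r' ^ 2 + 2 * r' + 2) := by ring
  rw [hN]
  constructor <;> field_simp <;> ring

lemma irrational_of_reciprocal_quadratic {T : ℤ} (hT : 3 ≤ T) {l : ℝ}
    (hl : l ^ 2 - T * l + 1 = 0) : Irrational l := by
  rintro ⟨q, rfl⟩
  have hq : q ^ 2 - T * q + 1 = 0 := by exact_mod_cast hl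
  have hd : (q.den : ℚ) ≠ 0 := by exact_mod_cast q.den_nz
  have h : q.num ^ 2 - T * q.num * q.den + (q.den : ℤ) ^ 2 = 0 := by
    rw [← Rat.num_div_den q] at hq
    field_simp at hq
    exact_mod_cast (by linarith : (q.num : ℚ) ^ 2 - T * q.num * q.den + (q.den : ℚ) ^ 2 = 0)
  have hcop : IsCoprime q.num (q.den : ℤ) := Rat.isCoprime_num_den q
  have hn : IsUnit q.num :=
    (hcop.pow_right (n := 2)).isUnit_of_dvd' dvd_rfl ⟨T * q.den - q.num, by linarith⟩
  have hden : IsUnit (q.den : ℤ) :=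
    (hcop.pow_left (m := 2)).isUnit_of_dvd' ⟨T * q.num - q.den, by linarith⟩ dvd_rfl
  rcases Int.isUnit_iff.1 hn with h₁ | h₁ <;> rcases Int.isUnit_iff.1 hden with h₂ | h₂ <;>
    rw [h₁, h₂] at h <;> omega

lemma prod_Mmat_eq_symSquare (ds : List (Fin 3)) :
    ∃ x y z w : ℤ, (ds.map Mmat).prod = symSquare x y z w ∧ 1 ≤ x ∧ 1 ≤ w ∧ 0 ≤ y ∧ 0 ≤ z ∧
      (x * w - y * z = 1 ∨ x * w - y * z = -1) ∧
      ((∀ d ∈ ds, d = 2) ∨ 1 ≤ y) ∧ ((∀ d ∈ ds, d = 0) ∨ 1 ≤ z) := by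
  induction ds with
  | nil => exact ⟨1, 0, 0, 1, by simp [symSquare_one], by simp⟩
  | cons d ds ih =>
    obtain ⟨x, y, z, w, hM, hx, hw, hy, hz, hdet, h2, h0⟩ := ih
    simp only [List.map_cons, List.prod_cons, hM, List.forall_mem_cons]
    fin_cases d
    · refine ⟨x + 2 * z, y + 2 * w, z, w, ?_, by omega, hw, by omega, hz, ?_, by omega, ?_⟩
      · simp [Mmat_zero_eq_symSquare, symSquare_mul]
      · convert hdet using 2 <;> ring
      · simpa using h0
    · refine ⟨x + 2 * z, y + 2 * w, x + z, y + w, ?_, by omega, by omega, by omega, by omega,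
        ?_, by omega, by omega⟩
      · simp [Mmat_one_eq_symSquare, symSquare_mul]
      · rcases hdet with h | h
        · right; linarith
        · left; linarith
    · refine ⟨x, y, x + z, y + w, ?_, hx, by omega, hy, by omega, ?_, ?_, by omega⟩
      · simp [Mmat_two_eq_symSquare, symSquare_mul]
      · convert hdet using 2 <;> ring
      · simpa using h2

/-- A real `2 × 2` matrix with positive off-diagonal entries has two real eigenvectors
`(r, 1)` and `(r', 1)` with `r` positive and `r'` negative. -/
lemma exists_eigen_slopes {x y z w δ : ℝ} (hy : 0 < y) (hz : 0 < z) (hδ : x * w - y * z = δ) :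
    ∃ r r' μ μ' : ℝ, 0 < r ∧ r' < 0 ∧ μ' < μ ∧ μ + μ' = x + w ∧ μ * μ' = δ ∧
      x * r + y = μ * r ∧ z * r + w = μ ∧ x * r' + y = μ' * r' ∧ z * r' + w = μ' := by
  have hyz := mul_pos hy hz
  obtain ⟨s, hs, hs2⟩ : ∃ s : ℝ, 0 ≤ s ∧ s ^ 2 = (x - w) ^ 2 + 4 * (y * z) :=
    ⟨√((x - w) ^ 2 + 4 * (y * z)), Real.sqrt_nonneg _, Real.sq_sqrt (by positivity)⟩
  have h₁ : |x - w| < s := abs_lt_of_sq_lt_sq (by linarith) hs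
  obtain ⟨h₁, h₂⟩ := abs_lt.1 h₁
  refine ⟨(x - w + s) / (2 * z), (x - w - s) / (2 * z), (x + w + s) / 2, (x + w - s) / 2,
    div_pos (by linarith) (by linarith), div_neg_of_neg_of_pos (by linarith) (by linarith),
    by linarith, by ring, by linarith, ?_, ?_, ?_, ?_⟩ <;> field_simp <;> linarith

theorem stmt_14 (ds : List (Fin 3)) (hne : ds ≠ [])
    (hnot1 : ¬ ∀ d ∈ ds, d = 0) (hnot3 : ¬ ∀ d ∈ ds, d = 2)
    (M : Matrix (Fin 3) (Fin 3) ℝ) (hM : M = (ds.map Mmat).prod) :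
    ∃ lam : ℝ, 1 < lam ∧ Irrational lam ∧
      lam ^ 2 - (M.trace - M.det) * lam + 1 = 0 ∧
      ∃ α β : ℝ, 0 ≤ α ∧ 0 ≤ β ∧ α ^ 2 + β ^ 2 = 1 ∧
        M.mulVec ![α, β, 1] = lam • ![α, β, 1] ∧
        ∃ a b c e : ℚ, α = (a : ℝ) + (b : ℝ) * lam ∧ β = (c : ℝ) + (e : ℝ) * lam ∧
          ∃ α' β' : ℝ, α' = (a : ℝ) + (b : ℝ) * lam⁻¹ ∧ β' = (c : ℝ) + (e : ℝ) * lam⁻¹ ∧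
            α' ^ 2 + β' ^ 2 = 1 ∧
            ¬(0 ≤ α' ∧ 0 ≤ β') ∧
            M.mulVec ![α', β', 1] = lam⁻¹ • ![α', β', 1] ∧
            (M.det = 1 ∨ M.det = -1) ∧
            qcross ![α, β, 1] ![α', β', 1] ≠ 0 ∧
            M.mulVec (qcross ![α, β, 1] ![α', β', 1]) =
              M.det • qcross ![α, β, 1] ![α', β', 1] := by
  obtain ⟨x, y, z, w, hS, hx, hw, -, -, hdet, h2, h0⟩ := prod_Mmat_eq_symSquare ds
  have hy : 1 ≤ y := h2.resolve_left hnot3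
  have hz : 1 ≤ z := h0.resolve_left hnot1
  rw [hS] at hM
  obtain ⟨δ, hδ⟩ : ∃ δ : ℤ, δ = x * w - y * z := ⟨_, rfl⟩
  rw [← hδ] at hdet
  have hδR : (x * w - y * z : ℝ) = δ := by rw [hδ]; push_cast; ring
  have hδsq : (δ : ℝ) * δ = 1 := by rcases hdet with h | h <;> simp [h]
  have hMdet : M.det = δ := by
    rw [hM, det_symSquare, hδR]
    linear_combination (δ : ℝ) * hδsq
  have hMtr : M.trace = (x + w) ^ 2 - δ := by rw [hM, trace_symSquare, hδR]
  have hyR : (0 : ℝ) < y := by exact_mod_cast hy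
  have hzR : (0 : ℝ) < z := by exact_mod_cast hz
  have htR : (0 : ℝ) < x + w := by exact_mod_cast (by omega : 0 < x + w)
  have hT : 3 ≤ (x + w) ^ 2 - 2 * δ := by
    rcases hdet with h | h
    · have h3 : 3 ≤ x + w := by
        by_contra! hlt
        obtain rfl : x = 1 := by omega
        obtain rfl : w = 1 := by omega
        nlinarith
      nlinarith
    · nlinarith
  obtain ⟨r, r', μ, μ', hr, hr', hμlt, hμadd, hμmul, h₁, h₂, h₁', h₂'⟩ :=
    exists_eigen_slopes hyR hzR hδR
  have hsq : μ ^ 2 * μ' ^ 2 = 1 := by rw [← mul_pow, hμmul, pow_two, hδsq]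
  have hμinv : (μ ^ 2)⁻¹ = μ' ^ 2 := inv_eq_of_mul_eq_one_right hsq
  have hquad : (μ ^ 2) ^ 2 - (((x + w) ^ 2 - 2 * δ : ℤ) : ℝ) * μ ^ 2 + 1 = 0 := by
    push_cast
    rw [← hμadd, ← hδsq, ← hμmul]
    ring
  have hlt : μ' ^ 2 < μ ^ 2 := by nlinarith
  have hsum : r + r' = (x - w) / z := by
    field_simp
    linarith
  have hprod : r * r' = -(y / z) := by
    field_simp
    linear_combination h₁ + r * h₂' + r * hμadd
  have hrlam : r = ((μ ^ 2 + δ) / (x + w) - w) / z := by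
    rw [eq_div_iff hzR.ne', eq_sub_iff_add_eq, eq_div_iff htR.ne']
    linear_combination (x + w : ℝ) * h₂ - μ * hμadd + hμmul
  have hrlam' : r' = ((μ' ^ 2 + δ) / (x + w) - w) / z := by
    rw [eq_div_iff hzR.ne', eq_sub_iff_add_eq, eq_div_iff htR.ne']
    linear_combination (x + w : ℝ) * h₂' - μ' * hμadd + hμmul
  obtain ⟨hα, hβ⟩ := circlePoint_affine hsum hprod
  obtain ⟨hα', hβ'⟩ := circlePoint_affine ((add_comm r' r).trans hsum) ((mul_comm r' r).trans hprod)
  have hv := symSquare_mulVec_circlePoint h₁ h₂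
  have hv' := symSquare_mulVec_circlePoint h₁' h₂'
  rw [← hM] at hv hv'
  have hpos := circlePoint_denom_pos r
  have hα0 : 0 ≤ (r ^ 2 + 2 * r) / (r ^ 2 + 2 * r + 2) := by positivity
  have hβ0 : 0 ≤ (2 * r + 2) / (r ^ 2 + 2 * r + 2) := by positivity
  have hneg := circlePoint_not_nonneg hr'
  let s : ℚ := (x - w) / z
  let k : ℚ := y / z
  let N : ℚ := -(s + 2) ^ 2 * k + (s + 2) * (k + 2) * s + (k + 2) ^ 2
  let r₀ : ℚ := (δ / (x + w) - w) / z
  let r₁ : ℚ := 1 / (x + w) / z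
  refine ⟨μ ^ 2, by nlinarith [sq_nonneg μ'], irrational_of_reciprocal_quadratic hT hquad, ?_,
    (r ^ 2 + 2 * r) / (r ^ 2 + 2 * r + 2), (2 * r + 2) / (r ^ 2 + 2 * r + 2), hα0, hβ0,
    circlePoint_norm r, hv,
    1 - 2 * ((s + 2) * (s - r₀) + k + 2) / N, 2 * (s + 2) * r₁ / N,
    2 * ((k - s) * r₀ + (s + 2) * (s - k) + k + 2) / N, 2 * (k - s) * r₁ / N, ?_, ?_,
    (r' ^ 2 + 2 * r') / (r' ^ 2 + 2 * r' + 2), (2 * r' + 2) / (r' ^ 2 + 2 * r' + 2), ?_, ?_,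
    circlePoint_norm r', hneg, ?_, ?_, ?_, ?_⟩
  · rw [hMdet, hMtr]
    push_cast at hquad
    linear_combination hquad
  · rw [hα, hrlam]
    simp only [N, s, k, r₀, r₁]
    push_cast
    ring
  · rw [hβ, hrlam]
    simp only [N, s, k, r₀, r₁]
    push_cast
    ring
  · rw [hα', hrlam', hμinv]
    simp only [N, s, k, r₀, r₁]
    push_cast
    ring
  · rw [hβ', hrlam', hμinv]
    simp only [N, s, k, r₀, r₁]
    push_cast
    ring
  · rw [hμinv]
    exact hv'
  · rw [hMdet]
    exact_mod_cast hdet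
  · intro h
    have e₀ := congrFun h 0
    have e₁ := congrFun h 1
    simp only [qcross, Matrix.cons_val_zero, Matrix.cons_val_one, Matrix.cons_val,
      Pi.zero_apply, mul_one] at e₀ e₁
    exact hneg ⟨by linarith, by linarith⟩
  · have hq := qcross_symSquare_mulVec x y z w (circlePoint r) (circlePoint r')
    rw [← hM, hv, hv', qcross_smul_smul, hsq, one_smul, hδR] at hq
    change M.mulVec (qcross (circlePoint r) (circlePoint r')) =
      M.det • qcross (circlePoint r) (circlePoint r')
    rw [hMdet]
    nth_rewrite 2 [hq]
    rw [smul_smul, hδsq, one_smul]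
end
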